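/- arXiv:2304.10919 — 3 statements merged into one kernel-verified Lean document; each statement's English description precedes it below -/
import Mathlib

section
/- Let m ≥ 1 and let μ : Fin m → ℂ be injective. In the polynomial ring R = MvPolynomial (Fin m) ℂ set q₁ = ∑_j (X j)² and q₂ = ∑_j (μ j) • (X j)², and for indices i, j and f ∈ R write D i j f = (X i) * (pderiv j f) − (X j) * (pderiv i f). Then for every index i and every f ∈ R: (a) ∑_{j ≠ i} (μ j − μ i)⁻¹ • ((D i j q₁) * (D i j f)) = 0, and (b) ∑_{j ≠ i} (μ j − μ i)⁻¹ • ((D i j q₂) * (D i j f)) = 2 • ((X i)² * ∑_j (X j) * (pderiv j f)) − 2 • (q₁ * (X i) * (pderiv i f)). -/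
open MvPolynomial

/-- The vector field `xᵢ ∂ⱼ − xⱼ ∂ᵢ` applied to a multivariate polynomial. -/
noncomputable def D {m : ℕ} (i j : Fin m) (f : MvPolynomial (Fin m) ℂ) :
    MvPolynomial (Fin m) ℂ :=
  X i * pderiv j f - X j * pderiv i f

theorem pderiv_sum_smul_X_sq {m : ℕ} (μ : Fin m → ℂ) (i : Fin m) :
    pderiv i (∑ k, μ k • X k ^ 2 : MvPolynomial (Fin m) ℂ) = μ i • (2 * X i) := by
  rw [map_sum, Finset.sum_eq_single i]
  · simp
  · intro k _ hk
    simp [pderiv_X_of_ne hk]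
  · simp

theorem D_sum_smul_X_sq {m : ℕ} (μ : Fin m → ℂ) (i j : Fin m) :
    D i j (∑ k, μ k • X k ^ 2) = (μ j - μ i) • (2 * X i * X j) := by
  rw [D, pderiv_sum_smul_X_sq, pderiv_sum_smul_X_sq]
  simp only [smul_eq_C_mul, C_sub]
  ring

theorem D_sum_X_sq {m : ℕ} (i j : Fin m) :
    D i j (∑ k, X k ^ 2) = 0 := by
  simpa using D_sum_smul_X_sq (fun _ => 1) i j

theorem quadratic_vector_fields_tangent (m : ℕ) (hm : 1 ≤ m) (μ : Fin m → ℂ)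
    (hμ : Function.Injective μ)
    (q₁ q₂ : MvPolynomial (Fin m) ℂ)
    (hq₁ : q₁ = ∑ j : Fin m, X j ^ 2)
    (hq₂ : q₂ = ∑ j : Fin m, μ j • X j ^ 2)
    (i : Fin m) (f : MvPolynomial (Fin m) ℂ) :
    (∑ j ∈ Finset.univ.erase i, (μ j - μ i)⁻¹ • (D i j q₁ * D i j f)) = 0 ∧
    (∑ j ∈ Finset.univ.erase i, (μ j - μ i)⁻¹ • (D i j q₂ * D i j f)) =
      2 • (X i ^ 2 * ∑ j : Fin m, X j * pderiv j f) -
        2 • (q₁ * X i * pderiv i f) := by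
  subst hq₁ hq₂
  constructor
  · refine Finset.sum_eq_zero fun j _ => ?_
    rw [D_sum_X_sq, zero_mul, smul_zero]
  · have h_term : ∀ j ∈ Finset.univ.erase i,
        (μ j - μ i)⁻¹ • (D i j (∑ k, μ k • X k ^ 2) * D i j f) = 2 * X i * X j * D i j f := by
      intro j hj
      have h_ne : μ j - μ i ≠ 0 := sub_ne_zero.mpr (hμ.ne (Finset.ne_of_mem_erase hj))
      rw [D_sum_smul_X_sq, smul_mul_assoc, inv_smul_smul₀ h_ne]
    rw [Finset.sum_congr rfl h_term, Finset.sum_erase _ (by simp [D])]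
    simp only [D, nsmul_eq_mul, Nat.cast_ofNat, Finset.mul_sum, Finset.sum_mul,
      ← Finset.sum_sub_distrib]
    exact Finset.sum_congr rfl fun j _ => by ring
end

section
/- Let V be a complex vector space with finrank ℂ V = n ≥ 1. Let α, β : Fin n → (V →ₗ[ℂ] ℂ) be two linearly independent families of linear forms, and let λ, λ' : Fin n → ℂ with λ injective. Assume that for every v ∈ V: ∑_i (α i v)² = ∑_i (β i v)² and ∑_i (λ i) * (α i v)² = ∑_i (λ' i) * (β i v)². Then there exists a permutation σ of Fin n such that for every i: λ' i = λ (σ i), and either β i = α (σ i) or β i = −(α (σ i)). -/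
/-- Two families of linear forms with the same weighted sum of squares have the same weighted
symmetric bilinear form. -/
theorem sum_mul_mul_eq_of_sum_mul_sq_eq {ι K V : Type*} [Fintype ι] [Field K] [CharZero K]
    [AddCommGroup V] [Module K V] {f g : ι → (V →ₗ[K] K)} {c d : ι → K}
    (h : ∀ v, ∑ i, c i * (f i v) ^ 2 = ∑ i, d i * (g i v) ^ 2) (u v : V) :
    ∑ i, c i * (f i u * f i v) = ∑ i, d i * (g i u * g i v) := by
  have key (c : ι → K) (f : ι → (V →ₗ[K] K)) : 2 * ∑ i, c i * (f i u * f i v) =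
      ∑ i, c i * (f i (u + v)) ^ 2 - ∑ i, c i * (f i u) ^ 2 - ∑ i, c i * (f i v) ^ 2 := by
    rw [Finset.mul_sum, ← Finset.sum_sub_distrib, ← Finset.sum_sub_distrib]
    refine Finset.sum_congr rfl fun i _ => ?_
    rw [map_add]
    ring
  apply mul_left_cancel₀ (two_ne_zero (α := K))
  rw [key, key, h, h, h]

/-- An orthogonal matrix conjugating a diagonal matrix with distinct entries to a diagonal matrix
is a signed permutation matrix. -/
theorem Matrix.exists_perm_of_transpose_mul_diagonal_mul {ι K : Type*} [Fintype ι] [DecidableEq ι]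
    [Field K] {C : Matrix ι ι K} {c d : ι → K} (hc : Function.Injective c)
    (hC : C.transpose * C = 1)
    (hd : C.transpose * Matrix.diagonal d * C = Matrix.diagonal c) :
    ∃ σ : Equiv.Perm ι, ∀ i, d i = c (σ i) ∧ (C i (σ i) = 1 ∨ C i (σ i) = -1) ∧
      ∀ j, j ≠ σ i → C i j = 0 := by
  have hC' : C * C.transpose = 1 := mul_eq_one_comm.mp hC
  have hcomm : Matrix.diagonal d * C = C * Matrix.diagonal c := by
    rw [← hd, ← Matrix.mul_assoc, ← Matrix.mul_assoc, hC', Matrix.one_mul]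
  have hentry (i j : ι) (hij : C i j ≠ 0) : d i = c j := by
    have h := congrFun₂ hcomm i j
    rw [Matrix.diagonal_mul, Matrix.mul_diagonal, mul_comm] at h
    exact mul_left_cancel₀ hij h
  have hrow (i k : ι) : ∑ j, C i j * C k j = (1 : Matrix ι ι K) i k := by
    simpa [Matrix.mul_apply] using congrFun₂ hC' i k
  have hex (i : ι) : ∃ j, C i j ≠ 0 := by
    by_contra! h
    simpa [h] using hrow i i
  choose s hs using hex
  have hzero (i j : ι) (hj : j ≠ s i) : C i j = 0 := by
    by_contra h
    exact hj (hc ((hentry i j h).symm.trans (hentry i _ (hs i))))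
  have hprod (i k : ι) : C i (s i) * C k (s i) = (1 : Matrix ι ι K) i k := by
    rw [← hrow, Finset.sum_eq_single (s i)]
    · intro j _ hj
      rw [hzero i j hj, zero_mul]
    · simp
  have hinj : Function.Injective s := by
    intro i k hik
    by_contra hne
    have h := hprod i k
    rw [Matrix.one_apply_ne hne] at h
    exact mul_ne_zero (hs i) (hik ▸ hs k) h
  refine ⟨Equiv.ofBijective s (Finite.injective_iff_bijective.mp hinj), fun i => ?_⟩
  refine ⟨hentry i _ (hs i), mul_self_eq_one_iff.mp ?_, hzero i⟩
  simpa using hprod i i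

theorem diagonalization_uniqueness (n : ℕ) (hn : 1 ≤ n)
    (V : Type*) [AddCommGroup V] [Module ℂ V]
    (hV : Module.finrank ℂ V = n)
    (α β : Fin n → (V →ₗ[ℂ] ℂ))
    (hα : LinearIndependent ℂ α) (hβ : LinearIndependent ℂ β)
    (lam lam' : Fin n → ℂ) (hlam : Function.Injective lam)
    (h1 : ∀ v : V, ∑ i : Fin n, (α i v) ^ 2 = ∑ i : Fin n, (β i v) ^ 2)
    (h2 : ∀ v : V,
      ∑ i : Fin n, lam i * (α i v) ^ 2 = ∑ i : Fin n, lam' i * (β i v) ^ 2) :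
    ∃ σ : Equiv.Perm (Fin n),
      ∀ i : Fin n, lam' i = lam (σ i) ∧ (β i = α (σ i) ∨ β i = -α (σ i)) := by
  have : Nonempty (Fin n) := ⟨⟨0, hn⟩⟩
  have : FiniteDimensional ℂ V := Module.finite_of_finrank_pos (by omega)
  let B : Module.Basis (Fin n) ℂ (Module.Dual ℂ V) :=
    basisOfLinearIndependentOfCardEqFinrank hα (by simp [Subspace.dual_finrank_eq, hV])
  have hB (i : Fin n) : B i = α i := by simp [B]
  let a (j : Fin n) : V := (Module.evalEquiv ℂ V).symm (B.coord j)
  have ha (f : V →ₗ[ℂ] ℂ) (j : Fin n) : f (a j) = B.repr f j :=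
    Module.apply_evalEquiv_symm_apply ℂ V f (B.coord j)
  have hαa (i j : Fin n) : α i (a j) = (1 : Matrix (Fin n) (Fin n) ℂ) i j := by
    rw [ha, ← hB, B.repr_self, Finsupp.single_apply, Matrix.one_apply]
  have hexpand (f : V →ₗ[ℂ] ℂ) : f = ∑ j, f (a j) • α j := by
    simp_rw [ha, ← hB]
    exact (B.sum_repr f).symm
  let C : Matrix (Fin n) (Fin n) ℂ := Matrix.of fun i j => β i (a j)
  have hgram (c d : Fin n → ℂ)
      (h : ∀ v, ∑ i, c i * (α i v) ^ 2 = ∑ i, d i * (β i v) ^ 2) :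
      C.transpose * Matrix.diagonal d * C = Matrix.diagonal c := by
    ext j k
    have hsum : (C.transpose * Matrix.diagonal d * C) j k =
        ∑ i, d i * (β i (a j) * β i (a k)) := by
      rw [Matrix.mul_apply]
      refine Finset.sum_congr rfl fun i _ => ?_
      rw [Matrix.mul_diagonal, Matrix.transpose_apply, mul_comm (C i j), mul_assoc]
      rfl
    rw [hsum, ← sum_mul_mul_eq_of_sum_mul_sq_eq h, Finset.sum_eq_single j]
    · simp [hαa, Matrix.one_apply, Matrix.diagonal_apply]
    · intro i _ hij
      rw [hαa i j, Matrix.one_apply_ne hij, zero_mul, mul_zero]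
    · simp
  have hC : C.transpose * C = 1 := by
    simpa using hgram 1 1 (by simpa using h1)
  have hD : C.transpose * Matrix.diagonal lam' * C = Matrix.diagonal lam := hgram lam lam' h2
  obtain ⟨σ, hσ⟩ := Matrix.exists_perm_of_transpose_mul_diagonal_mul hlam hC hD
  refine ⟨σ, fun i => ?_⟩
  obtain ⟨hl, hsign, hzero⟩ := hσ i
  have hβi : β i = C i (σ i) • α (σ i) := by
    rw [hexpand (β i)]
    refine Finset.sum_eq_single (σ i) (fun j _ hj => ?_) (by simp)
    have h0 : β i (a j) = 0 := hzero j hj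
    rw [h0, zero_smul]
  refine ⟨hl, hsign.imp (fun h => ?_) (fun h => ?_)⟩
  · rw [hβi, h, one_smul]
  · rw [hβi, h, neg_one_smul]
end

section
/- Let m ≥ 3 and let α : Fin m → ℂ be injective. Then there exists x : Fin m → ℂ such that ∑_i (x i)² = 0 and ∑_i (α i) * (x i)² = 0, but ∑_i (α i)² * (x i)² ≠ 0. -/
theorem base_locus_not_in_third_quadric (m : ℕ) (hm : 3 ≤ m)
    (α : Fin m → ℂ) (hα : Function.Injective α) :
    ∃ x : Fin m → ℂ,
      ∑ i : Fin m, (x i) ^ 2 = 0 ∧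
      ∑ i : Fin m, α i * (x i) ^ 2 = 0 ∧
      ∑ i : Fin m, (α i) ^ 2 * (x i) ^ 2 ≠ 0 := by
  obtain ⟨n, rfl⟩ := Nat.exists_eq_add_of_le' hm
  obtain ⟨a, ha⟩ : ∃ a, a = α 0 := ⟨_, rfl⟩
  obtain ⟨b, hb⟩ : ∃ b, b = α (Fin.succ 0) := ⟨_, rfl⟩
  obtain ⟨c, hc⟩ : ∃ c, c = α (Fin.succ (Fin.succ 0)) := ⟨_, rfl⟩
  have hab : a - b ≠ 0 := by
    rw [ha, hb, sub_ne_zero]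
    exact hα.ne (Fin.succ_ne_zero _).symm
  have hac : a - c ≠ 0 := by
    rw [ha, hc, sub_ne_zero]
    exact hα.ne (Fin.succ_ne_zero _).symm
  have hbc : b - c ≠ 0 := by
    rw [hb, hc, sub_ne_zero]
    exact hα.ne ((Fin.succ_injective _).ne (Fin.succ_ne_zero _).symm)
  obtain ⟨p, hp⟩ := IsAlgClosed.exists_pow_nat_eq (b - c) two_pos
  obtain ⟨q, hq⟩ := IsAlgClosed.exists_pow_nat_eq (c - a) two_pos
  obtain ⟨r, hr⟩ := IsAlgClosed.exists_pow_nat_eq (a - b) two_pos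
  have hsum (f : Fin (n + 3) → ℂ) :
      ∑ i, f i * (Fin.cons p (Fin.cons q (Fin.cons r 0)) : Fin (n + 3) → ℂ) i ^ 2 =
        f 0 * (b - c) + f (Fin.succ 0) * (c - a) + f (Fin.succ (Fin.succ 0)) * (a - b) := by
    simp only [Fin.sum_univ_succ, Fin.cons_zero, Fin.cons_succ, Pi.zero_apply, hp, hq, hr]
    simp [add_assoc]
  refine ⟨Fin.cons p (Fin.cons q (Fin.cons r 0)), ?_, ?_, ?_⟩
  · have h := hsum 1
    simp only [Pi.one_apply, one_mul] at h
    rw [h]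
    ring
  · rw [hsum α, ← ha, ← hb, ← hc]
    ring
  · rw [hsum fun i => α i ^ 2, ← ha, ← hb, ← hc]
    have h : a ^ 2 * (b - c) + b ^ 2 * (c - a) + c ^ 2 * (a - b) =
        (a - b) * (a - c) * (b - c) := by ring
    rw [h]
    exact mul_ne_zero (mul_ne_zero hab hac) hbc
end
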